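/- Let S be a countable set and let Q = (q(i,j))_{i,j∈S} be an irreducible proper Q-matrix on S that has a stationary distribution vector π with π(j) > 0 for all j, and assume that every subinvariant measure of Q is a positive scalar multiple of π. For each n ∈ ℕ let Q_n be a proper Q-matrix on S having a stationary distribution vector π_n, and assume lim_{n→∞} q_n(i,j) = q(i,j) for all i, j ∈ S. Then lim_{n→∞} Σ_{j∈S} |π_n(j) − π(j)| = 0 if and only if there exists a finite nonempty set A ⊆ S such that liminf_{n→∞} Σ_{j∈A} π_n(j) ≥ Σ_{j∈A} π(j). -/

import Mathlib

/-- A proper (stable and conservative) Q-matrix on a countable state space. -/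
def IsProperQMatrix {S : Type*} (q : S → S → ℝ) : Prop :=
  (∀ i, q i i ≤ 0) ∧ (∀ i j, i ≠ j → 0 ≤ q i j) ∧
  (∀ i, Summable (fun j : {j : S // j ≠ i} => q i (j : S)) ∧
    (∑' j : {j : S // j ≠ i}, q i (j : S)) = -q i i)

/-- Irreducibility: any two distinct states are connected by a finite path of
positive transition rates. -/
def IsIrreducibleQ {S : Type*} (q : S → S → ℝ) : Prop :=
  ∀ i j : S, i ≠ j → ∃ m : ℕ, 1 ≤ m ∧ ∃ c : ℕ → S, c 0 = i ∧ c m = j ∧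
    ∀ r < m, 0 < q (c r) (c (r + 1))

/-- A subinvariant measure of a proper Q-matrix: nonnegative, not identically zero,
with `∑_{i ≠ j} μ i * q i j ≤ -(μ j * q j j)` for every `j`. -/
def IsSubinvariantMeasure {S : Type*} (q : S → S → ℝ) (μ : S → ℝ) : Prop :=
  (∀ i, 0 ≤ μ i) ∧ μ ≠ 0 ∧
  ∀ j, Summable (fun i : {i : S // i ≠ j} => μ (i : S) * q (i : S) j) ∧
    (∑' i : {i : S // i ≠ j}, μ (i : S) * q (i : S) j) ≤ -(μ j * q j j)

/-- An invariant measure of a proper Q-matrix: nonnegative, not identically zero,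
with `∑_{i ≠ j} μ i * q i j = -(μ j * q j j)` for every `j`. -/
def IsInvariantMeasure {S : Type*} (q : S → S → ℝ) (μ : S → ℝ) : Prop :=
  (∀ i, 0 ≤ μ i) ∧ μ ≠ 0 ∧
  ∀ j, Summable (fun i : {i : S // i ≠ j} => μ (i : S) * q (i : S) j) ∧
    (∑' i : {i : S // i ≠ j}, μ (i : S) * q (i : S) j) = -(μ j * q j j)

/-- A stationary distribution vector of a proper Q-matrix: a probability vector `π`
with `∑_{i ≠ j} π i * q i j = -(π j * q j j)` for every `j`. -/
def IsStationaryDistVec {S : Type*} (q : S → S → ℝ) (π : S → ℝ) : Prop :=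
  (∀ j, 0 ≤ π j) ∧ Summable π ∧ (∑' j, π j) = 1 ∧
  ∀ j, Summable (fun i : {i : S // i ≠ j} => π (i : S) * q (i : S) j) ∧
    (∑' i : {i : S // i ≠ j}, π (i : S) * q (i : S) j) = -(π j * q j j)

open Filter

/-- The pointwise limit of stationary distribution vectors of `qn` along a nontrivial filter is
zero or a subinvariant measure of the pointwise limit of `qn`. -/
lemma IsStationaryDistVec.isSubinvariantMeasure_of_tendsto {S ι : Type*} {q : S → S → ℝ}
    (hq : IsProperQMatrix q) {qn : ι → S → S → ℝ} (hqn : ∀ n, IsProperQMatrix (qn n))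
    {πn : ι → S → ℝ} (hπn : ∀ n, IsStationaryDistVec (qn n) (πn n)) {l : Filter ι} [l.NeBot]
    (hconv : ∀ i j, Tendsto (fun n => qn n i j) l (nhds (q i j))) {μ : S → ℝ}
    (hμ : ∀ j, Tendsto (fun n => πn n j) l (nhds (μ j))) (hμ0 : μ ≠ 0) :
    IsSubinvariantMeasure q μ := by
  have hnonneg : ∀ i, 0 ≤ μ i := fun i => ge_of_tendsto' (hμ i) fun n => (hπn n).1 i
  refine ⟨hnonneg, hμ0, fun j => ?_⟩
  have hterm : ∀ i : {i : S // i ≠ j}, 0 ≤ μ (i : S) * q (i : S) j := fun i =>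
    mul_nonneg (hnonneg i) (hq.2.1 i j i.2)
  have hbound : ∀ F : Finset {i : S // i ≠ j},
      ∑ i ∈ F, μ (i : S) * q (i : S) j ≤ -(μ j * q j j) := by
    intro F
    refine le_of_tendsto_of_tendsto'
      (tendsto_finsetSum F fun i _ => (hμ (i : S)).mul (hconv (i : S) j))
      ((hμ j).mul (hconv j j)).neg fun n => ?_
    rw [← ((hπn n).2.2.2 j).2]
    exact ((hπn n).2.2.2 j).1.sum_le_tsum F fun i _ =>
      mul_nonneg ((hπn n).1 i) ((hqn n).2.1 i j i.2)
  have hsum := summable_of_sum_le hterm hbound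
  exact ⟨hsum, hsum.tsum_le_of_sum_le hbound⟩

/-- **Scheffé's lemma** for probability vectors: pointwise convergence implies convergence in
total variation. -/
lemma tendsto_tsum_abs_sub_of_tendsto {S ι : Type*} {l : Filter ι} {p : ι → S → ℝ} {π : S → ℝ}
    (hp : ∀ n j, 0 ≤ p n j) (hps : ∀ n, HasSum (p n) 1)
    (hπ : ∀ j, 0 ≤ π j) (hπs : HasSum π 1)
    (h : ∀ j, Tendsto (fun n => p n j) l (nhds (π j))) :
    Tendsto (fun n => ∑' j, |p n j - π j|) l (nhds 0) := by
  have hle : ∀ n j, max (π j - p n j) 0 ≤ π j := fun n j =>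
    max_le (by linarith [hp n j]) (hπ j)
  have hpos : ∀ n, Summable fun j => max (π j - p n j) 0 := fun n =>
    Summable.of_nonneg_of_le (fun _ => le_max_right _ _) (hle n) hπs.summable
  have heq : ∀ n, ∑' j, |p n j - π j| = 2 * ∑' j, max (π j - p n j) 0 := by
    intro n
    have h1 := ((hps n).sub hπs).add ((hpos n).hasSum.mul_left 2)
    rw [sub_self, zero_add] at h1
    rw [← h1.tsum_eq]
    refine tsum_congr fun j => ?_
    rcases le_total (π j) (p n j) with h | h
    · rw [abs_of_nonneg (by linarith), max_eq_right (by linarith)]; ring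
    · rw [abs_of_nonpos (by linarith), max_eq_left (by linarith)]; ring
  have hlim : Tendsto (fun n => ∑' j, max (π j - p n j) 0) l (nhds (∑' _ : S, (0 : ℝ))) := by
    refine tendsto_tsum_of_dominated_convergence hπs.summable (fun j => ?_)
      (Eventually.of_forall fun n j => ?_)
    · simpa using ((tendsto_const_nhds (x := π j)).sub (h j)).max
        (tendsto_const_nhds (x := (0 : ℝ)))
    · rw [Real.norm_of_nonneg (le_max_right _ _)]
      exact hle n j
  simp_rw [heq]
  simpa using hlim.const_mul 2

/-- Theorem B.1: the augmented truncation approximations `πn n` converge to `π` in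
total variation if and only if there is a finite nonempty set `A` on which the mass
of `πn n` is asymptotically at least that of `π`. -/
theorem stmt13 {S : Type*} [Countable S] (q : S → S → ℝ)
    (hq : IsProperQMatrix q) (hirr : IsIrreducibleQ q)
    (π : S → ℝ) (hπ : IsStationaryDistVec q π) (hπpos : ∀ j, 0 < π j)
    (huniq : ∀ μ : S → ℝ, IsSubinvariantMeasure q μ →
      ∃ c : ℝ, 0 < c ∧ ∀ j, μ j = c * π j)
    (qn : ℕ → S → S → ℝ) (hqn : ∀ n, IsProperQMatrix (qn n))
    (πn : ℕ → S → ℝ) (hπn : ∀ n, IsStationaryDistVec (qn n) (πn n))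
    (hconv : ∀ i j, Tendsto (fun n => qn n i j) atTop (nhds (q i j))) :
    Tendsto (fun n => ∑' j, |πn n j - π j|) atTop (nhds 0) ↔
      ∃ A : Finset S, A.Nonempty ∧
        (∑ j ∈ A, π j) ≤ liminf (fun n => ∑ j ∈ A, πn n j) atTop := by
  have hπs : HasSum π 1 := hπ.2.2.1 ▸ hπ.2.1.hasSum
  have hπns : ∀ n, HasSum (πn n) 1 := fun n => (hπn n).2.2.1 ▸ (hπn n).2.1.hasSum
  have hmass : ∀ n (F : Finset S), ∑ j ∈ F, πn n j ≤ 1 := fun n F =>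
    sum_le_hasSum F (fun j _ => (hπn n).1 j) (hπns n)
  constructor
  · intro h
    have hne : Nonempty S := by
      by_contra hS
      rw [not_nonempty_iff] at hS
      simpa using hπ.2.2.1
    obtain ⟨j⟩ := hne
    refine ⟨{j}, Finset.singleton_nonempty j, ?_⟩
    have hj : Tendsto (fun n => πn n j) atTop (nhds (π j)) := by
      rw [tendsto_iff_dist_tendsto_zero]
      refine squeeze_zero (fun _ => dist_nonneg) (fun n => ?_) h
      exact (((hπn n).2.1.sub hπ.2.1).abs).le_tsum j fun _ _ => abs_nonneg _
    simpa using hj.liminf_eq.ge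
  · rintro ⟨A, hA, hliminf⟩
    refine tendsto_tsum_abs_sub_of_tendsto (fun n => (hπn n).1) hπns hπ.1 hπs fun j => ?_
    rw [tendsto_iff_ultrafilter]
    intro U hU
    have hcpt : ∀ i, ∃ x, Tendsto (fun n => πn n i) U (nhds x) := by
      intro i
      obtain ⟨x, -, hx⟩ := (isCompact_Icc (a := (0 : ℝ)) (b := 1)).ultrafilter_le_nhds
        (U.map fun n => πn n i) (tendsto_principal.2 <| Eventually.of_forall fun n =>
          ⟨(hπn n).1 i, by simpa using hmass n {i}⟩)
      exact ⟨x, hx⟩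
    choose μ hμ using hcpt
    obtain ⟨c, hc⟩ : ∃ c : ℝ, ∀ i, μ i = c * π i := by
      by_cases hμ0 : μ = 0
      · exact ⟨0, fun i => by simp [hμ0]⟩
      · obtain ⟨c, -, hc⟩ := huniq μ <|
          IsStationaryDistVec.isSubinvariantMeasure_of_tendsto hq hqn hπn
            (fun i j => (hconv i j).mono_left hU) hμ hμ0
        exact ⟨c, hc⟩
    have hsum : ∀ F : Finset S,
        Tendsto (fun n => ∑ i ∈ F, πn n i) U (nhds (c * ∑ i ∈ F, π i)) := by
      intro F
      simp_rw [Finset.mul_sum, ← hc]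
      exact tendsto_finsetSum F fun i _ => hμ i
    have hc1 : c ≤ 1 := by
      have := le_of_tendsto' (hπs.mul_left c) fun F => by
        rw [← Finset.mul_sum]
        exact le_of_tendsto' (hsum F) fun n => hmass n F
      simpa using this
    have hApos : 0 < ∑ i ∈ A, π i := Finset.sum_pos (fun i _ => hπpos i) hA
    have hAle : ∑ i ∈ A, π i ≤ c * ∑ i ∈ A, π i := by
      refine le_of_forall_lt fun b hb => ?_
      obtain ⟨b', hbb', hb'⟩ := exists_between hb
      refine hbb'.trans_le (ge_of_tendsto (hsum A) ?_)
      refine hU ((eventually_lt_of_lt_liminf (hb'.trans_le hliminf) ?_).mono fun n hn => hn.le)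
      exact isBoundedUnder_of ⟨0, fun n => Finset.sum_nonneg fun i _ => (hπn n).1 i⟩
    have hc_eq : c = 1 := le_antisymm hc1 (by nlinarith)
    simpa [hc, hc_eq] using hμ j
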